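/- (Uniqueness of reduced Gröbner bases) Let K be a field, σ a finite type of indeterminates, and fix an admissible monomial order ≼ on σ →₀ ℕ. If A and B are reduced Gröbner bases in MvPolynomial σ K generating the same ideal, i.e., Ideal.span A = Ideal.span B, then A = B. -/

import Mathlib

open MvPolynomial Relation

/-- An admissible monomial order on `σ →₀ ℕ`: a linear order such that `0` is the
smallest element and which is compatible with addition. -/
structure AdmissibleOrder (σ : Type*) where
  le : (σ →₀ ℕ) → (σ →₀ ℕ) → Prop
  total : ∀ s t, le s t ∨ le t s
  refl : ∀ t, le t t
  trans : ∀ s t u, le s t → le t u → le s u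
  antisymm : ∀ s t, le s t → le t s → s = t
  zero_le : ∀ t, le 0 t
  add_right : ∀ s t u, le s t → le (s + u) (t + u)

namespace AdmissibleOrder

variable {σ : Type*} {K : Type*} [Field K]

/-- The strict part of an admissible order. -/
def lt (m : AdmissibleOrder σ) (s t : σ →₀ ℕ) : Prop := m.le s t ∧ s ≠ t

-- The leading monomial of a polynomial: the `m.le`-largest element of its support
-- (`0` for the zero polynomial).
open Classical in
noncomputable def lm (m : AdmissibleOrder σ) (p : MvPolynomial σ K) : σ →₀ ℕ :=
  if h : ∃ v, v ∈ p.support ∧ ∀ u ∈ p.support, m.le u v then h.choose else 0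

/-- The leading coefficient of a polynomial. -/
noncomputable def lc (m : AdmissibleOrder σ) (p : MvPolynomial σ K) : K :=
  coeff (m.lm p) p

/-- One-step polynomial reduction modulo a set `F`. -/
def Red (m : AdmissibleOrder σ) (F : Set (MvPolynomial σ K))
    (p q : MvPolynomial σ K) : Prop :=
  ∃ f ∈ F, f ≠ 0 ∧ ∃ t : σ →₀ ℕ,
    coeff (t + m.lm f) p ≠ 0 ∧
    q = p - (coeff (t + m.lm f) p / m.lc f) • (monomial t (1 : K)) * f

/-- A set `G` is a Gröbner basis iff the reduction relation modulo `G` is confluent. -/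
def IsGroebner (m : AdmissibleOrder σ) (G : Set (MvPolynomial σ K)) : Prop :=
  ∀ a b c : MvPolynomial σ K, ReflTransGen (m.Red G) a b → ReflTransGen (m.Red G) a c →
    ∃ d, ReflTransGen (m.Red G) b d ∧ ReflTransGen (m.Red G) c d

-- The S-polynomial of two polynomials.
open Classical in
noncomputable def spoly (m : AdmissibleOrder σ) (p q : MvPolynomial σ K) :
    MvPolynomial σ K :=
  if p = 0 ∨ q = 0 then 0 else
    (monomial (m.lm p ⊔ m.lm q - m.lm p) (1 / m.lc p)) * p -
    (monomial (m.lm p ⊔ m.lm q - m.lm q) (1 / m.lc q)) * q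

end AdmissibleOrder

/-- A finite set `B` is a reduced Gröbner basis iff it is a Gröbner basis, it is
auto-reduced (no `b ∈ B` is reducible modulo `B \ {b}`), `0 ∉ B`, and every element
of `B` is monic. -/
def AdmissibleOrder.IsReducedGroebner {σ K : Type*} [Field K] (m : AdmissibleOrder σ)
    (B : Set (MvPolynomial σ K)) : Prop :=
  B.Finite ∧ m.IsGroebner B ∧ (∀ b ∈ B, ¬ ∃ q, m.Red (B \ {b}) b q) ∧
    (0 : MvPolynomial σ K) ∉ B ∧ ∀ b ∈ B, m.lc b = 1

namespace AdmissibleOrder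

variable {σ K : Type*} [Field K]

theorem exists_greatest (m : AdmissibleOrder σ) {s : Finset (σ →₀ ℕ)} (hs : s.Nonempty) :
    ∃ v ∈ s, ∀ u ∈ s, m.le u v := by
  induction hs using Finset.Nonempty.cons_induction with
  | singleton a => exact ⟨a, by simp, by simp [m.refl]⟩
  | cons a s _ _ ih =>
    obtain ⟨v, hv, hmax⟩ := ih
    rcases m.total a v with hav | hva
    · refine ⟨v, Finset.mem_cons_of_mem hv, fun u hu ↦ ?_⟩
      rcases Finset.mem_cons.mp hu with rfl | hu
      exacts [hav, hmax u hu]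
    · refine ⟨a, Finset.mem_cons_self a s, fun u hu ↦ ?_⟩
      rcases Finset.mem_cons.mp hu with rfl | hu
      exacts [m.refl u, m.trans _ _ _ (hmax u hu) hva]

theorem lm_spec (m : AdmissibleOrder σ) {p : MvPolynomial σ K} (hp : p ≠ 0) :
    m.lm p ∈ p.support ∧ ∀ u ∈ p.support, m.le u (m.lm p) := by
  have h := m.exists_greatest (support_nonempty.mpr hp)
  rw [lm, dif_pos h]
  exact h.choose_spec

theorem lc_ne_zero (m : AdmissibleOrder σ) {p : MvPolynomial σ K} (hp : p ≠ 0) : m.lc p ≠ 0 :=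
  mem_support_iff.mp (m.lm_spec hp).1

theorem le_lm (m : AdmissibleOrder σ) {p : MvPolynomial σ K} {u : σ →₀ ℕ} (hu : coeff u p ≠ 0) :
    m.le u (m.lm p) :=
  (m.lm_spec (ne_zero_iff.mpr ⟨u, hu⟩)).2 u (mem_support_iff.mpr hu)

theorem le_of_le (m : AdmissibleOrder σ) {s t : σ →₀ ℕ} (h : s ≤ t) : m.le s t := by
  have := m.add_right 0 (t - s) s (m.zero_le _)
  rwa [zero_add, tsub_add_cancel_of_le h] at this

theorem le_of_coeff_monomial_mul (m : AdmissibleOrder σ) {f : MvPolynomial σ K} {t u : σ →₀ ℕ}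
    (h : coeff u (monomial t (1 : K) * f) ≠ 0) : m.le u (t + m.lm f) := by
  rw [coeff_monomial_mul', one_mul] at h
  obtain ⟨htu, hu⟩ := ite_ne_right_iff.mp h
  have := m.add_right _ _ t (m.le_lm hu)
  rwa [tsub_add_cancel_of_le htu, add_comm] at this

theorem reflTransGen_red_sub (m : AdmissibleOrder σ) {G : Set (MvPolynomial σ K)}
    {f : MvPolynomial σ K} (hf : f ∈ G) (hf0 : f ≠ 0) (t : σ →₀ ℕ) (p : MvPolynomial σ K) :
    ReflTransGen (m.Red G) p
      (p - (coeff (t + m.lm f) p / m.lc f) • (monomial t (1 : K)) * f) := by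
  by_cases hc : coeff (t + m.lm f) p = 0
  · simp only [hc, zero_div, zero_smul, zero_mul, sub_zero]
    exact .refl
  · exact .single ⟨f, hf, hf0, t, hc, rfl⟩

theorem exists_join_add_smul_monomial_mul (m : AdmissibleOrder σ) {G : Set (MvPolynomial σ K)}
    {f : MvPolynomial σ K} (hf : f ∈ G) (hf0 : f ≠ 0) (t : σ →₀ ℕ) (c : K)
    (p : MvPolynomial σ K) :
    ∃ d, ReflTransGen (m.Red G) p d ∧
      ReflTransGen (m.Red G) (p + c • (monomial t (1 : K)) * f) d := by
  refine ⟨_, m.reflTransGen_red_sub hf hf0 t p, ?_⟩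
  convert m.reflTransGen_red_sub hf hf0 t (p + c • (monomial t (1 : K)) * f) using 1
  have hlc := m.lc_ne_zero hf0
  have hcoeff : coeff (t + m.lm f) (p + c • (monomial t (1 : K)) * f) =
      coeff (t + m.lm f) p + c * m.lc f := by
    rw [coeff_add, smul_mul_assoc, coeff_smul, coeff_monomial_mul, one_mul, smul_eq_mul, lc]
  rw [hcoeff, add_div, mul_div_cancel_right₀ _ hlc, add_smul]
  ring

theorem eq_zero_of_reflTransGen_zero (m : AdmissibleOrder σ) {G : Set (MvPolynomial σ K)}
    {q : MvPolynomial σ K} (h : ReflTransGen (m.Red G) 0 q) : q = 0 := by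
  rcases ReflTransGen.cases_head h with h | ⟨_, ⟨_, _, _, _, hc, _⟩, _⟩
  · exact h.symm
  · exact absurd (coeff_zero _) hc

theorem IsGroebner.reflTransGen_add_smul_monomial_mul {m : AdmissibleOrder σ}
    {G : Set (MvPolynomial σ K)} (hG : m.IsGroebner G) {f : MvPolynomial σ K} (hf : f ∈ G)
    (t : σ →₀ ℕ) (c : K) {p : MvPolynomial σ K} (hp : ReflTransGen (m.Red G) p 0) :
    ReflTransGen (m.Red G) (p + c • (monomial t (1 : K)) * f) 0 := by
  by_cases hf0 : f = 0
  · simpa [hf0] using hp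
  obtain ⟨d, hpd, hqd⟩ := m.exists_join_add_smul_monomial_mul hf hf0 t c p
  obtain ⟨e, hde, h0e⟩ := hG p d 0 hpd hp
  rw [m.eq_zero_of_reflTransGen_zero h0e] at hde
  exact hqd.trans hde

theorem IsGroebner.reflTransGen_add_mul {m : AdmissibleOrder σ}
    {G : Set (MvPolynomial σ K)} (hG : m.IsGroebner G) {f : MvPolynomial σ K} (hf : f ∈ G)
    (r : MvPolynomial σ K) {p : MvPolynomial σ K} (hp : ReflTransGen (m.Red G) p 0) :
    ReflTransGen (m.Red G) (p + r * f) 0 := by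
  induction r using MvPolynomial.induction_on' generalizing p with
  | monomial t c =>
    have := hG.reflTransGen_add_smul_monomial_mul hf t c hp
    rwa [smul_monomial, smul_eq_mul, mul_one] at this
  | add r s hr hs =>
    rw [add_mul, ← add_assoc]
    exact hs (hr hp)

theorem IsGroebner.reflTransGen_zero_of_mem_span {m : AdmissibleOrder σ}
    {G : Set (MvPolynomial σ K)} (hG : m.IsGroebner G) {p : MvPolynomial σ K}
    (hp : p ∈ Ideal.span G) : ReflTransGen (m.Red G) p 0 := by
  suffices ∀ q, ReflTransGen (m.Red G) q 0 → ReflTransGen (m.Red G) (q + p) 0 by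
    simpa using this 0 .refl
  induction hp using Submodule.closure_induction with
  | zero => simp
  | add x y _ _ hx hy =>
    intro q hq
    rw [← add_assoc]
    exact hy _ (hx q hq)
  | smul_mem r x hx => exact fun q hq ↦ hG.reflTransGen_add_mul hx r hq

theorem coeff_of_reflTransGen (m : AdmissibleOrder σ) {G : Set (MvPolynomial σ K)}
    {v : σ →₀ ℕ} (hv : ∀ g ∈ G, ¬ m.lm g ≤ v) {p q : MvPolynomial σ K}
    (hpq : ReflTransGen (m.Red G) p q) (hp : ∀ u, coeff u p ≠ 0 → m.le u v) :
    coeff v q = coeff v p ∧ ∀ u, coeff u q ≠ 0 → m.le u v := by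
  induction hpq with
  | refl => exact ⟨rfl, hp⟩
  | tail _ hred ih =>
    obtain ⟨hcoeff, hle⟩ := ih
    obtain ⟨f, hf, -, t, hc, rfl⟩ := hred
    have htv := hle _ hc
    have hlow : ∀ u, coeff u (monomial t (1 : K) * f) ≠ 0 → m.le u v :=
      fun u hu ↦ m.trans _ _ _ (m.le_of_coeff_monomial_mul hu) htv
    have hv0 : coeff v (monomial t (1 : K) * f) = 0 := by
      by_contra hne
      exact hv f hf (m.antisymm _ _ (m.le_of_coeff_monomial_mul hne) htv ▸ le_add_self)
    refine ⟨by simp [hv0, hcoeff], fun u hu ↦ ?_⟩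
    by_contra hnot
    rw [smul_mul_assoc, coeff_sub, coeff_smul, not_imp_comm.mp (hle u) hnot,
      not_imp_comm.mp (hlow u) hnot] at hu
    simp at hu

theorem IsGroebner.exists_lm_le {m : AdmissibleOrder σ}
    {G : Set (MvPolynomial σ K)} (hG : m.IsGroebner G) {p : MvPolynomial σ K}
    (hp : p ∈ Ideal.span G) (hp0 : p ≠ 0) : ∃ g ∈ G, m.lm g ≤ m.lm p := by
  by_contra! hnone
  have h := m.coeff_of_reflTransGen hnone (hG.reflTransGen_zero_of_mem_span hp)
    fun _ ↦ m.le_lm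
  exact m.lc_ne_zero hp0 (h.1.symm.trans (coeff_zero _))

namespace IsReducedGroebner

variable {m : AdmissibleOrder σ} {A B : Set (MvPolynomial σ K)}

theorem ne_zero (hB : m.IsReducedGroebner B) {b : MvPolynomial σ K} (hb : b ∈ B) : b ≠ 0 :=
  ne_of_mem_of_not_mem hb hB.2.2.2.1

theorem eq_of_lm_le (hB : m.IsReducedGroebner B) {b g : MvPolynomial σ K} (hb : b ∈ B)
    (hg : g ∈ B) {x : σ →₀ ℕ} (hx : coeff x b ≠ 0) (hgx : m.lm g ≤ x) : g = b := by
  by_contra hne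
  refine hB.2.2.1 b hb ⟨_, g, ⟨hg, hne⟩, hB.ne_zero hg, x - m.lm g, ?_, rfl⟩
  rwa [tsub_add_cancel_of_le hgx]

theorem coeff_lm_eq_zero (hB : m.IsReducedGroebner B) {b p : MvPolynomial σ K} (hb : b ∈ B)
    (hp : p ∈ Ideal.span B) (hp0 : p ≠ 0) (hne : m.lm p ≠ m.lm b) : coeff (m.lm p) b = 0 := by
  by_contra hx
  obtain ⟨g, hg, hgx⟩ := hB.2.1.exists_lm_le hp hp0
  obtain rfl := hB.eq_of_lm_le hb hg hx hgx
  exact hne (m.antisymm _ _ (m.le_lm hx) (m.le_of_le hgx))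

theorem subset_of_span_eq (hA : m.IsReducedGroebner A) (hB : m.IsReducedGroebner B)
    (h : Ideal.span A = Ideal.span B) : A ⊆ B := by
  intro a ha
  have haA := Ideal.subset_span ha
  obtain ⟨b, hb, hba⟩ := hB.2.1.exists_lm_le (h ▸ haA) (hA.ne_zero ha)
  have hbA : b ∈ Ideal.span A := h ▸ Ideal.subset_span hb
  obtain ⟨g, hg, hgb⟩ := hA.2.1.exists_lm_le hbA (hB.ne_zero hb)
  obtain rfl := hA.eq_of_lm_le ha hg (m.lc_ne_zero (hA.ne_zero ha)) (hgb.trans hba)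
  have hlm : m.lm g = m.lm b := le_antisymm hgb hba
  suffices g - b = 0 from sub_eq_zero.mp this ▸ hb
  by_contra hne
  have hmem : g - b ∈ Ideal.span A := sub_mem haA hbA
  have hlmne : m.lm (g - b) ≠ m.lm g := by
    intro heq
    have hga : coeff (m.lm g) g = 1 := hA.2.2.2.2 g ha
    have hbb : coeff (m.lm b) b = 1 := hB.2.2.2.2 b hb
    apply m.lc_ne_zero hne
    rw [lc, heq, coeff_sub, hga, hlm, hbb, sub_self]
  apply m.lc_ne_zero hne
  rw [lc, coeff_sub, hA.coeff_lm_eq_zero ha hmem hne hlmne,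
    hB.coeff_lm_eq_zero hb (h ▸ hmem) hne (hlm ▸ hlmne), sub_self]

end IsReducedGroebner

end AdmissibleOrder


/-- Uniqueness of reduced Gröbner bases: two reduced Gröbner bases generating the same
ideal are equal. -/
theorem reduced_groebner_unique {σ K : Type*} [Fintype σ] [Field K] (m : AdmissibleOrder σ)
    (A B : Set (MvPolynomial σ K)) (hA : m.IsReducedGroebner A) (hB : m.IsReducedGroebner B)
    (h : Ideal.span A = Ideal.span B) :
    A = B :=
  (hA.subset_of_span_eq hB h).antisymm (hB.subset_of_span_eq hA h.symm)
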